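/- If F is a Schwartz SO(3)-invariant function on ℝ³×ℝ³ such that ∫_{ℝ³×ℝ³} F(x,y)·conj(φ_{λ,l,r}(x,y)) dx dy = 0 for all λ>0, l∈ℕ, r∈ℝ, and ∫_{ℝ³×ℝ³} F(x,y)·φ_{0,R}(x,y) dx dy = 0 for all R≥0, then F = 0. (Injectivity of the Gelfand/spherical transform on 𝒮(N_{3,2})^{SO(3)}, part of the main isomorphism theorem.) -/

import Mathlib

open MeasureTheory Complex Matrix

noncomputable section

abbrev V3 := Fin 3 → ℝ
abbrev Mat3 := Matrix (Fin 3) (Fin 3) ℝ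

instance : MeasurableSpace Mat3 := (inferInstance : MeasurableSpace (Fin 3 → Fin 3 → ℝ))

/-- The set of special orthogonal 3×3 real matrices. -/
def SO3 : Set Mat3 := {A | A * A.transpose = 1 ∧ A.det = 1}

/-- `SO(3)`-invariance of a function on `ℝ³ × ℝ³` (simultaneous action on both factors). -/
def Inv3 (F : V3 × V3 → ℂ) : Prop :=
  ∀ k ∈ SO3, ∀ x y : V3, F (k.mulVec x, k.mulVec y) = F (x, y)

/-- `μ` is the Haar probability measure of `SO(3)`, viewed as a measure on the space of
matrices: a left-invariant Borel probability measure concentrated on `SO3`.  (On the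
compact metrizable group `SO(3)` such a measure is unique.) -/
def IsHaarSO3 (μ : Measure Mat3) : Prop :=
  IsProbabilityMeasure μ ∧ μ SO3ᶜ = 0 ∧ ∀ k ∈ SO3, μ.map (fun A => k * A) = μ

/-- The Laguerre function of order 0: `𝓛_l(u) = (1/l!) e^{u/2} (d/du)^l (u^l e^{-u})`. -/
def lag (l : ℕ) (u : ℝ) : ℝ :=
  (l.factorial : ℝ)⁻¹ * Real.exp (u / 2) * deriv^[l] (fun v : ℝ => v ^ l * Real.exp (-v)) u

/-- The regular bounded spherical functions `φ_{λ,l,r}` of `(SO(3) ⋉ N_{3,2}, SO(3))`: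
`φ_{λ,l,r}(x,y) = ∫_{SO(3)} e^{-iλ(ky)₃} 𝓛_l((λ/2)((kx)₁² + (kx)₂²)) e^{-ir(kx)₃} dk`. -/
def sph (μ : Measure Mat3) (lam : ℝ) (l : ℕ) (r : ℝ) (x y : V3) : ℂ :=
  ∫ k, Complex.exp (-(Complex.I * lam * ((k.mulVec y) 2))) *
      (lag l (lam / 2 * (((k.mulVec x) 0) ^ 2 + ((k.mulVec x) 1) ^ 2)) : ℝ) *
      Complex.exp (-(Complex.I * r * ((k.mulVec x) 2))) ∂μ

/-- The Euclidean norm on `ℝ³`. -/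
def nrm3 (x : V3) : ℝ := Real.sqrt (x 0 ^ 2 + x 1 ^ 2 + x 2 ^ 2)

/-- The singular bounded spherical functions `φ_{0,R}(x,y) = sin(R|x|)/(R|x|)`,
interpreted as `1` when `R|x| = 0`. -/
def sph0 (R : ℝ) (x : V3) : ℝ :=
  if R * nrm3 x = 0 then 1 else Real.sin (R * nrm3 x) / (R * nrm3 x)



lemma aux_moment_uniq {Ω : Type*} [MeasurableSpace Ω] (m : Measure Ω) (q : Ω → ℝ) (hq : Measurable q)
    (hq0 : ∀ w, 0 ≤ q w) (f0 : ℝ → ℝ) (hf0 : Measurable f0)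
    (hint : Integrable (fun w => f0 (q w)) m) (c : ℝ) (hc : 0 < c)
    (hmom : ∀ n : ℕ, ∫ w, f0 (q w) * (q w) ^ n * Real.exp (-(c * q w)) ∂m = 0) :
    ∀ᵐ w ∂m, f0 (q w) = 0 := by
  have hbd : ∀ t ≤ c, ∀ w, Real.exp (t * q w) * Real.exp (-(c * q w)) ≤ 1 := by
    intro t ht w
    rw [← Real.exp_add]
    apply Real.exp_le_one_iff.2
    nlinarith [hq0 w]
  -- two densities
  have key : ∀ (g : ℝ → ℝ), Measurable g → (∀ s, 0 ≤ g s) → Integrable (fun w => g (q w)) m →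
      IsFiniteMeasure (m.withDensity fun w => ENNReal.ofReal (g (q w) * Real.exp (-(c * q w)))) ∧
      (∀ t ≤ c, t ∈ ProbabilityTheory.integrableExpSet q
        (m.withDensity fun w => ENNReal.ofReal (g (q w) * Real.exp (-(c * q w))))) ∧
      ∀ n : ℕ, ∫ w, ((q w : ℝ) : ℂ) ^ n ∂(m.withDensity fun w => ENNReal.ofReal (g (q w) * Real.exp (-(c * q w))))
        = ((∫ w, g (q w) * (q w) ^ n * Real.exp (-(c * q w)) ∂m : ℝ) : ℂ) := by
    intro g hg hg0 hgi
    have hm : Measurable (fun w => g (q w) * Real.exp (-(c * q w))) := by fun_prop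
    refine ⟨?_, ?_, ?_⟩
    · apply isFiniteMeasure_withDensity_ofReal
      refine (hgi.mono hm.aestronglyMeasurable ?_).2
      filter_upwards with w
      rw [norm_mul, Real.norm_of_nonneg (Real.exp_pos _).le]
      have := hbd 0 hc.le w
      simp only [zero_mul, Real.exp_zero, one_mul] at this
      exact mul_le_of_le_one_right (norm_nonneg _) this
    · intro t ht
      simp only [ProbabilityTheory.integrableExpSet, Set.mem_ofPred_eq]
      rw [integrable_withDensity_iff_integrable_smul₀' (by fun_prop) (by simp)]
      refine hgi.mono (by fun_prop) ?_
      filter_upwards with w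
      rw [ENNReal.toReal_ofReal (mul_nonneg (hg0 _) (Real.exp_pos _).le), smul_eq_mul,
        mul_assoc, norm_mul]
      refine mul_le_of_le_one_right (norm_nonneg _) ?_
      rw [Real.norm_of_nonneg (by positivity), mul_comm]
      exact hbd t ht w
    · intro n
      rw [integral_withDensity_eq_integral_toReal_smul (by fun_prop) (by simp), ← integral_complex_ofReal]
      congr 1; ext w
      rw [ENNReal.toReal_ofReal (mul_nonneg (hg0 _) (Real.exp_pos _).le)]
      rw [Complex.real_smul]; push_cast; ring
  obtain ⟨F1, E1, M1⟩ := key (fun s => max (f0 s) 0) (by fun_prop) (fun s => le_max_right _ _) hint.pos_part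
  obtain ⟨F2, E2, M2⟩ := key (fun s => max (-f0 s) 0) (by fun_prop) (fun s => le_max_right _ _) hint.neg_part
  set P1 := m.withDensity fun w => ENNReal.ofReal (max (f0 (q w)) 0 * Real.exp (-(c * q w))) with hP1
  set P2 := m.withDensity fun w => ENNReal.ofReal (max (-f0 (q w)) 0 * Real.exp (-(c * q w))) with hP2
  have hmint : ∀ (n : ℕ) (g : ℝ → ℝ), Measurable g → Integrable (fun w => g (q w)) m →
      Integrable (fun w => g (q w) * (q w) ^ n * Real.exp (-(c * q w))) m := by
    intro n g hg hgi
    have hb : ∀ w, ‖(q w) ^ n * Real.exp (-(c * q w))‖ ≤ n.factorial / c ^ n := by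
      intro w
      rw [Real.norm_of_nonneg (by have := hq0 w; positivity), le_div_iff₀ (by positivity)]
      have h1 := Real.pow_div_factorial_le_exp (c * q w) (mul_nonneg hc.le (hq0 w)) n
      rw [div_le_iff₀ (by positivity)] at h1
      rw [Real.exp_neg]
      have := Real.exp_pos (c * q w)
      rw [mul_pow] at h1
      field_simp
      nlinarith
    have := hgi.bdd_mul (c := n.factorial / c ^ n) (f := fun w => (q w) ^ n * Real.exp (-(c * q w)))
      (by fun_prop) (Filter.Eventually.of_forall hb)
    refine this.congr (Filter.Eventually.of_forall fun w => ?_)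
    simp only []; ring
  have hM : ∀ n : ℕ, ∫ w, ((q w : ℝ) : ℂ) ^ n ∂P1 = ∫ w, ((q w : ℝ) : ℂ) ^ n ∂P2 := by
    intro n
    rw [M1, M2]
    congr 1
    rw [← sub_eq_zero, ← integral_sub (hmint n (fun s => max (f0 s) 0) (by fun_prop) hint.pos_part)
      (hmint n (fun s => max (-f0 s) 0) (by fun_prop) hint.neg_part)]
    refine Eq.trans ?_ (hmom n)
    congr 1; ext w
    rcases le_total 0 (f0 (q w)) with h | h
    · rw [max_eq_left h, max_eq_right (by linarith)]; ring
    · rw [max_eq_right h, max_eq_left (by linarith)]; ring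
  -- analytic
  have hI : ∀ {P : Measure Ω}, (∀ t ≤ c, t ∈ ProbabilityTheory.integrableExpSet q P) →
      ∀ t < c, t ∈ interior (ProbabilityTheory.integrableExpSet q P) := by
    intro P h t ht
    exact interior_mono (s := Set.Iic c) h (by simpa using ht)
  have hA : ∀ {P : Measure Ω}, (∀ t ≤ c, t ∈ ProbabilityTheory.integrableExpSet q P) →
      AnalyticOnNhd ℂ (ProbabilityTheory.complexMGF q P) {z : ℂ | z.re < c} := by
    intro P h z hz
    exact ProbabilityTheory.analyticAt_complexMGF (hI h _ hz)
  have hE : Set.EqOn (ProbabilityTheory.complexMGF q P1) (ProbabilityTheory.complexMGF q P2)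
      {z : ℂ | z.re < c} := by
    refine (hA E1).eqOn_of_preconnected_of_eventuallyEq (hA E2)
      (convex_halfSpace_re_lt c).isPreconnected (z₀ := 0) (by simpa using hc) ?_
    have a1 := (hA E1 0 (by simpa using hc)).hasFPowerSeriesAt
    have a2 := (hA E2 0 (by simpa using hc)).hasFPowerSeriesAt
    have : (fun n : ℕ => iteratedDeriv n (ProbabilityTheory.complexMGF q P1) 0 / (n.factorial : ℂ)) =
        (fun n : ℕ => iteratedDeriv n (ProbabilityTheory.complexMGF q P2) 0 / (n.factorial : ℂ)) := by
      ext n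
      rw [ProbabilityTheory.iteratedDeriv_complexMGF (hI E1 _ (by simpa using hc)),
        ProbabilityTheory.iteratedDeriv_complexMGF (hI E2 _ (by simpa using hc))]
      simp [hM n]
    rw [this] at a1
    have h3 := a1.sub a2
    rw [sub_self] at h3
    filter_upwards [h3.eventually_eq_zero] with z hz
    exact sub_eq_zero.1 hz
  have hmap : P1.map q = P2.map q := by
    apply Measure.ext_of_charFun
    ext t
    rw [charFun_apply_real, charFun_apply_real, integral_map hq.aemeasurable (by fun_prop),
      integral_map hq.aemeasurable (by fun_prop)]
    have := hE (x := (t : ℂ) * Complex.I) (by simpa using hc)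
    simp only [ProbabilityTheory.complexMGF] at this
    convert this using 3 <;> ring_nf
  -- conclude
  have fin : ∀ B : Set ℝ, MeasurableSet B → P1 (q ⁻¹' B) = P2 (q ⁻¹' B) := by
    intro B hB
    rw [← Measure.map_apply hq hB, hmap, Measure.map_apply hq hB]
  have c1 : ∀ᵐ w ∂m, f0 (q w) ≤ 0 := by
    have hB : MeasurableSet {s | 0 < f0 s} := measurableSet_lt measurable_const hf0
    have h := fin _ hB
    have h0 : P2 (q ⁻¹' {s | 0 < f0 s}) = 0 := by
      rw [hP2, withDensity_apply _ (hq hB), setLIntegral_eq_zero_iff (hq hB) (by fun_prop)]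
      filter_upwards with w hw
      have : 0 < f0 (q w) := hw
      rw [max_eq_right (show -f0 (q w) ≤ 0 by linarith)]; simp
    rw [h0, hP1, withDensity_apply _ (hq hB), setLIntegral_eq_zero_iff (hq hB) (by fun_prop)] at h
    filter_upwards [h] with w hw
    by_contra hcon
    push Not at hcon
    have := hw hcon
    rw [max_eq_left hcon.le, ENNReal.ofReal_eq_zero] at this
    have := mul_pos hcon (Real.exp_pos (-(c * q w)))
    linarith
  have c2 : ∀ᵐ w ∂m, 0 ≤ f0 (q w) := by
    have hB : MeasurableSet {s | f0 s < 0} := measurableSet_lt hf0 measurable_const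
    have h := (fin _ hB).symm
    have h0 : P1 (q ⁻¹' {s | f0 s < 0}) = 0 := by
      rw [hP1, withDensity_apply _ (hq hB), setLIntegral_eq_zero_iff (hq hB) (by fun_prop)]
      filter_upwards with w hw
      have : f0 (q w) < 0 := hw
      rw [max_eq_right this.le]; simp
    rw [h0, hP2, withDensity_apply _ (hq hB), setLIntegral_eq_zero_iff (hq hB) (by fun_prop)] at h
    filter_upwards [h] with w hw
    by_contra hcon
    push Not at hcon
    have := hw hcon
    rw [max_eq_left (by linarith), ENNReal.ofReal_eq_zero] at this
    have := mul_pos (neg_pos.2 hcon) (Real.exp_pos (-(c * q w)))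
    linarith
  filter_upwards [c1, c2] with w h1 h2 using le_antisymm h1 h2

lemma aux_deriv_poly (m : ℕ) : ∀ p : Polynomial ℝ, ∃ r : Polynomial ℝ, r.degree = p.degree ∧
    ∀ u : ℝ, deriv^[m] (fun v : ℝ => p.eval v * Real.exp (-v)) u = r.eval u * Real.exp (-u) := by
  induction m with
  | zero => intro p; exact ⟨p, rfl, fun u => rfl⟩
  | succ m ih =>
    intro p
    obtain ⟨r, hr, h⟩ := ih (p.derivative - p)
    refine ⟨r, ?_, fun u => ?_⟩
    · rw [hr]
      by_cases hp : p = 0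
      · simp [hp]
      · exact Polynomial.degree_sub_eq_right_of_degree_lt (Polynomial.degree_derivative_lt hp)
    · rw [Function.iterate_succ_apply, ← h u]
      refine congrFun (congrArg _ ?_) u
      ext v
      have h1 := (p.hasDerivAt v).mul ((hasDerivAt_neg v).exp)
      have h2 : HasDerivAt (fun v : ℝ => p.eval v * Real.exp (-v))
        (p.derivative.eval v * Real.exp (-v) + p.eval v * (Real.exp (-v) * -1)) v := h1
      rw [h2.deriv, Polynomial.eval_sub]; ring

lemma aux_lag_poly : ∃ S : Polynomial.Sequence ℝ, ∀ (l : ℕ) (u : ℝ),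
    lag l u = (S l).eval u * Real.exp (-(u / 2)) := by
  have : ∀ l : ℕ, ∃ r : Polynomial ℝ, r.degree = l ∧ ∀ u : ℝ, lag l u = r.eval u * Real.exp (-(u / 2)) := by
    intro l
    obtain ⟨r, hr, h⟩ := aux_deriv_poly l (Polynomial.X ^ l)
    refine ⟨Polynomial.C ((l.factorial : ℝ)⁻¹) * r, ?_, fun u => ?_⟩
    · rw [Polynomial.degree_C_mul (by positivity), hr, Polynomial.degree_X_pow]
    · have := h u
      simp only [Polynomial.eval_pow, Polynomial.eval_X] at this
      rw [lag, this, Polynomial.eval_mul, Polynomial.eval_C]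
      have e : Real.exp (-(u/2)) = Real.exp (u/2) * Real.exp (-u) := by
        rw [← Real.exp_add]; ring_nf
      rw [e]; ring
  choose r hr h using this
  exact ⟨⟨r, hr⟩, h⟩

lemma aux_poly_bdd (p : Polynomial ℝ) : ∃ C : ℝ, ∀ u : ℝ, 0 ≤ u →
    |p.eval u * Real.exp (-(u / 2))| ≤ C := by
  induction p using Polynomial.induction_on' with
  | add p q hp hq =>
    obtain ⟨C, hC⟩ := hp
    obtain ⟨D, hD⟩ := hq
    refine ⟨C + D, fun u hu => ?_⟩
    rw [Polynomial.eval_add, add_mul]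
    exact (abs_add_le _ _).trans (add_le_add (hC u hu) (hD u hu))
  | monomial n a =>
    refine ⟨|a| * (2 ^ n * n.factorial), fun u hu => ?_⟩
    rw [Polynomial.eval_monomial, mul_assoc, abs_mul]
    gcongr
    rw [abs_of_nonneg (by positivity), Real.exp_neg]
    have h1 := Real.pow_div_factorial_le_exp (u / 2) (by positivity) n
    rw [div_le_iff₀ (by positivity), div_pow, div_le_iff₀ (by positivity)] at h1
    rw [← div_eq_mul_inv, div_le_iff₀ (Real.exp_pos _)]
    linarith

lemma aux_lag_bdd (l : ℕ) : ∃ C : ℝ, ∀ u : ℝ, 0 ≤ u → |lag l u| ≤ C := by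
  obtain ⟨S, hS⟩ := aux_lag_poly
  simp_rw [hS]
  exact aux_poly_bdd _

lemma aux_lag_cont (l : ℕ) : Continuous (lag l) := by
  obtain ⟨S, hS⟩ := aux_lag_poly
  have : lag l = fun u => (S l).eval u * Real.exp (-(u / 2)) := funext (hS l)
  rw [this]
  fun_prop

lemma aux_radial (g : (Fin 2 → ℝ) → ℂ) (hg : Continuous g) (hgi : Integrable g)
    (hrad : ∀ v, g v = g ![Real.sqrt (v 0 ^ 2 + v 1 ^ 2), 0]) (lam : ℝ) (hl : 0 < lam)
    (h : ∀ l : ℕ, ∫ v, g v * ((lag l (lam / 2 * (v 0 ^ 2 + v 1 ^ 2)) : ℝ) : ℂ) = 0) : g = 0 := by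
  obtain ⟨S, hS⟩ := aux_lag_poly
  have hq0 : ∀ v : Fin 2 → ℝ, 0 ≤ lam / 2 * (v 0 ^ 2 + v 1 ^ 2) := fun v => by positivity
  have hI : ∀ p : Polynomial ℝ, Integrable (fun v : Fin 2 → ℝ => g v *
      ((p.eval (lam / 2 * (v 0 ^ 2 + v 1 ^ 2)) * Real.exp (-(lam / 2 * (v 0 ^ 2 + v 1 ^ 2) / 2)) : ℝ) : ℂ)) := by
    intro p
    obtain ⟨C, hC⟩ := aux_poly_bdd p
    refine hgi.mul_bdd (c := C) (Continuous.aestronglyMeasurable (by fun_prop)) (Filter.Eventually.of_forall fun v => ?_)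
    rw [Complex.norm_real]
    exact hC _ (hq0 v)
  have hall : ∀ p : Polynomial ℝ, ∫ v : Fin 2 → ℝ, g v *
      ((p.eval (lam / 2 * (v 0 ^ 2 + v 1 ^ 2)) * Real.exp (-(lam / 2 * (v 0 ^ 2 + v 1 ^ 2) / 2)) : ℝ) : ℂ) = 0 := by
    intro p
    have hp : p ∈ Submodule.span ℝ (Set.range S) := by
      rw [S.span (fun i => (Polynomial.leadingCoeff_ne_zero.2 (S.ne_zero i)).isUnit)]; trivial
    induction hp using Submodule.span_induction with
    | mem x hx =>
      obtain ⟨l, rfl⟩ := hx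
      have := h l
      simp_rw [hS] at this
      exact this
    | zero => simp
    | add x y _ _ hx hy =>
      rw [← add_zero (0 : ℂ)]
      nth_rewrite 1 [← hx]
      rw [← hy, ← integral_add (hI x) (hI y)]
      congr 1; ext v
      rw [Polynomial.eval_add]; push_cast; ring
    | smul a x _ hx =>
      rw [← mul_zero (a : ℂ), ← hx, ← integral_const_mul]
      congr 1; ext v
      rw [Polynomial.eval_smul, smul_eq_mul]; push_cast; ring
  have hmono : ∀ n : ℕ, ∫ v : Fin 2 → ℝ, g v *
      (((v 0 ^ 2 + v 1 ^ 2) ^ n * Real.exp (-(lam / 4 * (v 0 ^ 2 + v 1 ^ 2))) : ℝ) : ℂ) = 0 := by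
    intro n
    rw [← hall (Polynomial.C ((2 / lam) ^ n) * Polynomial.X ^ n)]
    congr 1; ext v
    congr 2
    simp only [Polynomial.eval_mul, Polynomial.eval_C, Polynomial.eval_pow, Polynomial.eval_X]
    rw [← mul_pow]
    congr 2
    · field_simp
    · ring
  have hmI : ∀ n : ℕ, Integrable (fun v : Fin 2 → ℝ => g v *
      (((v 0 ^ 2 + v 1 ^ 2) ^ n * Real.exp (-(lam / 4 * (v 0 ^ 2 + v 1 ^ 2))) : ℝ) : ℂ)) := by
    intro n
    convert hI (Polynomial.C ((2 / lam) ^ n) * Polynomial.X ^ n) using 1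
    ext v
    congr 2
    simp only [Polynomial.eval_mul, Polynomial.eval_C, Polynomial.eval_pow, Polynomial.eval_X]
    rw [← mul_pow]
    congr 2
    · field_simp
    · ring
  have hre := aux_moment_uniq (volume : Measure (Fin 2 → ℝ)) (fun v => v 0 ^ 2 + v 1 ^ 2) (by fun_prop)
    (fun v => by positivity) (fun s => (g ![Real.sqrt s, 0]).re) (by
      apply Continuous.measurable; fun_prop) (by
      simp_rw [← hrad]; exact hgi.re) (lam / 4) (by positivity) (by
      intro n
      simp_rw [← hrad]
      have := congrArg Complex.re (hmono n)
      have h2 := integral_re (𝕜 := ℂ) (hmI n)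
      simp only [RCLike.re_to_complex] at h2
      rw [← h2] at this
      rw [Complex.zero_re] at this
      rw [← this]
      congr 1; ext v
      rw [Complex.re_mul_ofReal]; ring)
  have him := aux_moment_uniq (volume : Measure (Fin 2 → ℝ)) (fun v => v 0 ^ 2 + v 1 ^ 2) (by fun_prop)
    (fun v => by positivity) (fun s => (g ![Real.sqrt s, 0]).im) (by
      apply Continuous.measurable; fun_prop) (by
      simp_rw [← hrad]; exact hgi.im) (lam / 4) (by positivity) (by
      intro n
      simp_rw [← hrad]
      have := congrArg Complex.im (hmono n)
      have h2 := integral_im (𝕜 := ℂ) (hmI n)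
      simp only [RCLike.im_to_complex] at h2
      rw [← h2] at this
      rw [Complex.zero_im] at this
      rw [← this]
      congr 1; ext v
      rw [Complex.im_mul_ofReal]; ring)
  apply Continuous.ae_eq_iff_eq (volume : Measure (Fin 2 → ℝ)) hg continuous_zero |>.1
  filter_upwards [hre, him] with v h1 h2
  rw [← hrad] at h1 h2
  exact Complex.ext h1 h2

open scoped FourierTransform in
lemma aux_fourier {E : Type*} [NormedAddCommGroup E] [InnerProductSpace ℝ E] [FiniteDimensional ℝ E]
    [MeasurableSpace E] [BorelSpace E] [Nontrivial E] (f : E → ℂ) (hf : Continuous f) (hfi : Integrable f)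
    (h : ∀ w : E, w ≠ 0 → ∫ v, f v * Complex.exp (Complex.I * ((inner ℝ v w : ℝ) : ℂ)) = 0) : f = 0 := by
  have h0 : ∀ w : E, w ≠ 0 → 𝓕 f w = 0 := by
    intro w hw
    rw [Real.fourier_eq', ← h (-(2 * Real.pi) • w) (by simp [hw, Real.pi_ne_zero])]
    congr 1; ext v
    rw [smul_eq_mul, mul_comm, inner_smul_right]
    congr 2
    push_cast; ring
  have hae : 𝓕 f =ᵐ[volume] 0 := by
    have : ∀ᵐ w : E, w ≠ 0 := by
      rw [ae_iff]; simp
    filter_upwards [this] with w hw using h0 w hw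
  have hinv := hf.fourierInv_fourier_eq hfi ((integrable_zero E ℂ volume).congr hae.symm)
  rw [← hinv]
  ext v
  rw [Real.fourierInv_eq', integral_eq_zero_of_ae]
  · rfl
  · filter_upwards [hae] with w hw
    rw [hw]; simp

lemma aux_fourier_real (f : ℝ → ℂ) (hf : Continuous f) (hfi : Integrable f)
    (h : ∀ r : ℝ, ∫ t, f t * Complex.exp (Complex.I * r * t) = 0) : f = 0 := by
  apply aux_fourier f hf hfi
  intro w _
  rw [← h w]
  congr 1; ext v
  congr 2
  simp [mul_assoc]

lemma aux_fourier_V3 (f : V3 → ℂ) (hf : Continuous f) (hfi : Integrable f)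
    (h : ∀ w : V3, w ≠ 0 → ∫ y : V3, f y * Complex.exp (Complex.I * ((w ⬝ᵥ y : ℝ) : ℂ)) = 0) : f = 0 := by
  have hp := PiLp.volume_preserving_ofLp (Fin 3)
  have he : MeasurableEmbedding (WithLp.ofLp : EuclideanSpace ℝ (Fin 3) → V3) :=
    (MeasurableEquiv.toLp 2 (Fin 3 → ℝ)).symm.measurableEmbedding
  have key : (fun v : EuclideanSpace ℝ (Fin 3) => f v.ofLp) = 0 := by
    apply aux_fourier
    · fun_prop
    · exact (hp.integrable_comp_emb he).2 hfi
    · intro w hw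
      have := h w.ofLp (by simpa using hw)
      rw [← hp.integral_comp he] at this
      rw [← this]
      rfl
  ext y
  exact congrFun key (WithLp.toLp 2 y)

lemma aux_mp (k : Mat3) (hk : k ∈ SO3) : MeasurePreserving (fun y : V3 => k.mulVec y) := by
  refine ⟨by fun_prop, ?_⟩
  have := Real.map_matrix_volume_pi_eq_smul_volume_pi (M := k) (by rw [hk.2]; simp)
  rw [hk.2] at this
  simp only [inv_one, abs_one, ENNReal.ofReal_one, one_smul] at this
  exact this

lemma aux_emb (k : Mat3) (hk : k ∈ SO3) : MeasurableEmbedding (fun y : V3 => k.mulVec y) := by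
  have h1 : k * k.transpose = 1 := hk.1
  have h2 : k.transpose * k = 1 := mul_eq_one_comm.1 h1
  refine MeasurableEquiv.measurableEmbedding ⟨⟨fun y => k.mulVec y, fun y => k.transpose.mulVec y, ?_, ?_⟩, ?_, ?_⟩
  · intro y; simp [Matrix.mulVec_mulVec, h2]
  · intro y; simp [Matrix.mulVec_mulVec, h1]
  · simp only [Equiv.coe_fn_mk]; fun_prop
  · simp only [Equiv.coe_fn_symm_mk]; fun_prop

lemma aux_mp2 (k : Mat3) (hk : k ∈ SO3) (f : V3 × V3 → ℂ) :
    ∫ p : V3 × V3, f (k.mulVec p.1, k.mulVec p.2) = ∫ p : V3 × V3, f p :=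
  ((aux_mp k hk).prod (aux_mp k hk)).integral_comp
    ((aux_emb k hk).prodMap (aux_emb k hk)) f

/-- partial Fourier transform -/
def pft (F : V3 × V3 → ℂ) (x w : V3) : ℂ := ∫ y : V3, F (x, y) * Complex.exp (Complex.I * ((w ⬝ᵥ y : ℝ) : ℂ))

lemma aux_dot (k : Mat3) (hk : k ∈ SO3) (w y : V3) : (k.mulVec w) ⬝ᵥ (k.mulVec y) = w ⬝ᵥ y := by
  have h1 : k * k.transpose = 1 := hk.1
  have h2 : k.transpose * k = 1 := mul_eq_one_comm.1 h1
  rw [Matrix.dotProduct_mulVec, Matrix.vecMul_mulVec, h2]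
  simp

lemma aux_pft_inv (F : V3 × V3 → ℂ) (hF : Inv3 F) (k : Mat3) (hk : k ∈ SO3) (x w : V3) :
    pft F (k.mulVec x) (k.mulVec w) = pft F x w := by
  unfold pft
  rw [← (aux_mp k hk).integral_comp (aux_emb k hk)]
  congr 1; ext y
  rw [hF k hk, aux_dot k hk]

lemma aux_so3 (a b c s : ℝ) (h1 : a ^ 2 + b ^ 2 = 1) (h2 : c ^ 2 + s ^ 2 = 1) :
    (!![a * c, b * c, -s; -b, a, 0; a * s, b * s, c] : Mat3) ∈ SO3 := by
  constructor
  · ext i j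
    fin_cases i <;> fin_cases j <;>
    simp [Matrix.mul_apply, Fin.sum_univ_three] <;> 
    first
    | ring1
    | linear_combination h1
    | linear_combination c ^ 2 * h1 + h2
    | linear_combination s ^ 2 * h1 + h2
    | linear_combination c * s * h1
  · rw [Matrix.det_fin_three]
    simp
    linear_combination (c ^ 2 + s ^ 2) * h1 + h2

lemma aux_polar (u v : ℝ) : ∃ a b : ℝ, a ^ 2 + b ^ 2 = 1 ∧ u = a * Real.sqrt (u ^ 2 + v ^ 2) ∧
    v = b * Real.sqrt (u ^ 2 + v ^ 2) := by
  by_cases h : u ^ 2 + v ^ 2 = 0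
  · refine ⟨1, 0, by norm_num, ?_, ?_⟩ <;> rw [h] <;> simp <;> nlinarith [sq_nonneg u, sq_nonneg v]
  · have h1 : 0 < u ^ 2 + v ^ 2 := lt_of_le_of_ne (by positivity) (Ne.symm h)
    have h2 := Real.sqrt_pos.2 h1
    refine ⟨u / Real.sqrt (u ^ 2 + v ^ 2), v / Real.sqrt (u ^ 2 + v ^ 2), ?_, ?_, ?_⟩
    · rw [div_pow, div_pow, Real.sq_sqrt h1.le]; field_simp
    · field_simp
    · field_simp

/-- transitivity on spheres -/
lemma aux_trans (w : V3) (hw : w ≠ 0) : ∃ k ∈ SO3, ∃ lam > (0:ℝ), k.mulVec w = ![0, 0, lam] := by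
  obtain ⟨a, b, h1, hu, hv⟩ := aux_polar (w 0) (w 1)
  set ρ := Real.sqrt (w 0 ^ 2 + w 1 ^ 2) with hρ
  obtain ⟨c, s, h2, hc, hs⟩ := aux_polar (w 2) ρ
  set R := Real.sqrt (w 2 ^ 2 + ρ ^ 2) with hR
  have hRpos : 0 < R := by
    refine lt_of_le_of_ne (Real.sqrt_nonneg _) ?_
    intro h0
    apply hw
    rw [← h0] at hc hs
    simp only [mul_zero] at hc hs
    rw [hs] at hu hv
    ext i; fin_cases i
    · simpa using hu
    · simpa using hv
    · simpa using hc
  refine ⟨_, aux_so3 a b c s h1 h2, R, hRpos, ?_⟩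
  ext i
  have hu' : w 0 = a * s * R := by rw [hu, hs]; ring
  have hv' : w 1 = b * s * R := by rw [hv, hs]; ring
  fin_cases i <;> simp [Matrix.mulVec, dotProduct, Fin.sum_univ_three] <;> rw [hu', hv'] <;> try rw [hc]
  · linear_combination c * s * R * h1
  · ring
  · linear_combination s ^ 2 * R * h1 + R * h2

/-- rotation about the third axis -/
lemma aux_rot (u v t : ℝ) : ∃ k ∈ SO3, (∀ lam : ℝ, k.mulVec ![0, 0, lam] = ![0, 0, lam]) ∧
    k.mulVec ![u, v, t] = ![Real.sqrt (u ^ 2 + v ^ 2), 0, t] := by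
  obtain ⟨a, b, h1, hu, hv⟩ := aux_polar u v
  set ρ := Real.sqrt (u ^ 2 + v ^ 2) with hρ
  refine ⟨_, aux_so3 a b 1 0 h1 (by norm_num), ?_, ?_⟩
  · intro lam
    ext i; fin_cases i <;> simp [Matrix.mulVec, dotProduct, Fin.sum_univ_three]
  · ext i; fin_cases i <;> simp [Matrix.mulVec, dotProduct, Fin.sum_univ_three]
    · rw [hu, hv]; linear_combination ρ * h1
    · rw [hu, hv]; ring

lemma aux_decay (F : SchwartzMap (V3 × V3) ℂ) : ∃ C : ℝ, 0 ≤ C ∧ ∀ x y : V3,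
    ‖F (x, y)‖ ≤ C * ((1 + ‖x‖) ^ (-4 : ℝ) * (1 + ‖y‖) ^ (-4 : ℝ)) := by
  have h := SchwartzMap.one_add_le_sup_seminorm_apply (𝕜 := ℂ) (m := (8, 0)) (k := 8) (n := 0) le_rfl le_rfl F
  simp only [norm_iteratedFDeriv_zero] at h
  refine ⟨2 ^ 8 * ((Finset.Iic ((8, 0) : ℕ × ℕ)).sup fun m => SchwartzMap.seminorm ℂ m.1 m.2) F, by positivity, ?_⟩
  intro x y
  have h1 := h (x, y)
  have hx : 0 < 1 + ‖x‖ := by positivity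
  have hy : 0 < 1 + ‖y‖ := by positivity
  rw [Real.rpow_neg hx.le, Real.rpow_neg hy.le, ← mul_inv, ← div_eq_mul_inv, le_div_iff₀ (by positivity)]
  refine le_trans ?_ h1
  rw [mul_comm]
  have e : ∀ z : ℝ, z ^ (4 : ℝ) = z ^ 4 := fun z => by exact_mod_cast Real.rpow_natCast z 4
  rw [e, e]
  gcongr
  have n1 : ‖x‖ ≤ ‖(x, y)‖ := norm_fst_le (x, y)
  have n2 : ‖y‖ ≤ ‖(x, y)‖ := norm_snd_le (x, y)
  calc (1 + ‖x‖) ^ 4 * (1 + ‖y‖) ^ 4 ≤ (1 + ‖(x, y)‖) ^ 4 * (1 + ‖(x, y)‖) ^ 4 := by gcongr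
    _ = _ := by ring

lemma aux_int4 {n : ℕ} (hn : n < 4) : Integrable (fun y : Fin n → ℝ => (1 + ‖y‖) ^ (-4 : ℝ)) := by
  apply integrable_one_add_norm
  simp
  exact_mod_cast hn

lemma aux_Fint (F : SchwartzMap (V3 × V3) ℂ) : Integrable (F : V3 × V3 → ℂ) volume := by
  obtain ⟨C, hC0, hC⟩ := aux_decay F
  have h := ((aux_int4 (n := 3) (by norm_num)).mul_prod (aux_int4 (n := 3) (by norm_num))).const_mul C
  rw [← Measure.volume_eq_prod] at h
  exact h.mono' F.continuous.aestronglyMeasurable (Filter.Eventually.of_forall fun p => hC p.1 p.2)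

lemma aux_normexp (s : ℝ) : ‖Complex.exp (Complex.I * (s : ℂ))‖ = 1 := by
  rw [mul_comm]; exact Complex.norm_exp_ofReal_mul_I s

lemma aux_pft_decay (F : SchwartzMap (V3 × V3) ℂ) (w : V3) : ∃ C : ℝ, 0 ≤ C ∧ ∀ x : V3,
    ‖pft F x w‖ ≤ C * (1 + ‖x‖) ^ (-4 : ℝ) := by
  obtain ⟨C, hC0, hC⟩ := aux_decay F
  refine ⟨C * ∫ y : V3, (1 + ‖y‖) ^ (-4 : ℝ), mul_nonneg hC0 (integral_nonneg fun y => by positivity), ?_⟩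
  intro x
  have : ‖pft F x w‖ ≤ ∫ y : V3, C * (1 + ‖x‖) ^ (-4 : ℝ) * (1 + ‖y‖) ^ (-4 : ℝ) := by
    apply norm_integral_le_of_norm_le ((aux_int4 (by norm_num)).const_mul _)
    filter_upwards with y
    rw [norm_mul, aux_normexp, mul_one, mul_assoc]
    exact hC x y
  rw [integral_const_mul] at this
  linarith

lemma aux_pft_cont (F : SchwartzMap (V3 × V3) ℂ) (w : V3) : Continuous fun x => pft F x w := by
  obtain ⟨C, hC0, hC⟩ := aux_decay F
  have hFc : Continuous F := F.continuous
  refine continuous_of_dominated (bound := fun y => C * (1 + ‖y‖) ^ (-4 : ℝ)) ?_ ?_ ?_ ?_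
  · intro x
    apply Continuous.aestronglyMeasurable
    simp only [dotProduct]
    fun_prop
  · intro x
    filter_upwards with y
    rw [norm_mul, aux_normexp, mul_one]
    refine (hC x y).trans ?_
    gcongr
    refine mul_le_of_le_one_left (by positivity) ?_
    exact Real.rpow_le_one_of_one_le_of_nonpos (by linarith [norm_nonneg x]) (by norm_num)
  · exact (aux_int4 (by norm_num)).const_mul _
  · filter_upwards with y
    fun_prop

lemma aux_pft_int (F : SchwartzMap (V3 × V3) ℂ) (w : V3) : Integrable fun x => pft F x w := by
  obtain ⟨C, hC0, hC⟩ := aux_pft_decay F w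
  exact ((aux_int4 (by norm_num)).const_mul C).mono' (aux_pft_cont F w).aestronglyMeasurable
    (Filter.Eventually.of_forall hC)

instance aux_borel : BorelSpace Mat3 := inferInstanceAs (BorelSpace (Fin 3 → Fin 3 → ℝ))
instance aux_sc : SecondCountableTopology Mat3 := inferInstanceAs (SecondCountableTopology (Fin 3 → Fin 3 → ℝ))

def EE (lam : ℝ) (l : ℕ) (r : ℝ) (p : V3 × V3) : ℂ :=
  Complex.exp (Complex.I * ((lam * p.2 2 : ℝ) : ℂ)) * ((lag l (lam / 2 * (p.1 0 ^ 2 + p.1 1 ^ 2)) : ℝ) : ℂ) *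
    Complex.exp (Complex.I * ((r * p.1 2 : ℝ) : ℂ))

lemma aux_EE_cont (lam : ℝ) (l : ℕ) (r : ℝ) : Continuous (EE lam l r) := by
  have := aux_lag_cont l
  unfold EE
  fun_prop

lemma aux_EE_bdd (lam : ℝ) (hl : 0 < lam) (l : ℕ) (r : ℝ) : ∃ C, ∀ p, ‖EE lam l r p‖ ≤ C := by
  obtain ⟨C, hC⟩ := aux_lag_bdd l
  refine ⟨C, fun p => ?_⟩
  rw [EE, norm_mul, norm_mul, aux_normexp, aux_normexp, one_mul, mul_one, Complex.norm_real]
  exact hC _ (by positivity)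

lemma aux_red1 (μ : Measure Mat3) (hμ : IsHaarSO3 μ)
    (F : SchwartzMap (V3 × V3) ℂ) (hF : Inv3 ⇑F) (lam : ℝ) (hl : 0 < lam) (l : ℕ) (r : ℝ)
    (h : ∫ p : V3 × V3, F p * (starRingEnd ℂ) (sph μ lam l r p.1 p.2) = 0) :
    ∫ p : V3 × V3, F p * EE lam l r p = 0 := by
  obtain ⟨hpr, hc, -⟩ := hμ
  obtain ⟨C, hC⟩ := aux_EE_bdd lam hl l r
  have h1 : ∀ p : V3 × V3, F p * (starRingEnd ℂ) (sph μ lam l r p.1 p.2) =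
      ∫ k, F p * EE lam l r (k.mulVec p.1, k.mulVec p.2) ∂μ := by
    intro p
    rw [integral_const_mul, sph, ← integral_conj]
    congr 2; ext k
    simp only [EE, map_mul, ← Complex.exp_conj, map_neg, Complex.conj_I, Complex.conj_ofReal]
    push_cast
    congr 2 <;> ring_nf
  simp_rw [h1] at h
  rw [integral_integral_swap] at h
  · rw [integral_congr_ae (g := fun _ => ∫ p : V3 × V3, F p * EE lam l r p)] at h
    · simpa using h
    · have : ∀ᵐ k ∂μ, k ∈ SO3 := hc
      filter_upwards [this] with k hk
      rw [← aux_mp2 k hk (fun p => F p * EE lam l r p)]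
      congr 1; ext p
      rw [hF k hk]
  · have hint : Integrable (F : V3 × V3 → ℂ) volume := aux_Fint F
    refine (hint.comp_fst μ).mul_bdd (c := C) ?_ (Filter.Eventually.of_forall fun z => hC _)
    apply Continuous.aestronglyMeasurable
    have := aux_EE_cont lam l r
    apply this.comp
    exact (Continuous.matrix_mulVec continuous_snd (continuous_fst.comp continuous_fst)).prodMk
      (Continuous.matrix_mulVec continuous_snd (continuous_snd.comp continuous_fst))

lemma aux_red2 (F : SchwartzMap (V3 × V3) ℂ) (lam : ℝ) (hl : 0 < lam) (l : ℕ) (r : ℝ)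
    (h : ∫ p : V3 × V3, F p * EE lam l r p = 0) :
    ∫ x : V3, pft F x ![0, 0, lam] * ((lag l (lam / 2 * (x 0 ^ 2 + x 1 ^ 2)) : ℝ) : ℂ) *
      Complex.exp (Complex.I * r * x 2) = 0 := by
  obtain ⟨C, hC⟩ := aux_EE_bdd lam hl l r
  have hint : Integrable (F : V3 × V3 → ℂ) volume := aux_Fint F
  rw [Measure.volume_eq_prod, integral_prod] at h
  · rw [← h]
    congr 1; ext x
    rw [pft, mul_assoc, ← integral_mul_const]
    congr 1; ext y
    simp only [EE, dotProduct, Fin.sum_univ_three]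
    simp
    ring_nf
  · exact hint.mul_bdd (c := C) (aux_EE_cont lam l r).aestronglyMeasurable (Filter.Eventually.of_forall hC)

lemma aux_ins (t : ℝ) (v : Fin 2 → ℝ) : (Fin.insertNth (α := fun _ => ℝ) 2 t v : V3) = ![v 0, v 1, t] := by
  ext i; fin_cases i <;> rfl

lemma aux_split : MeasurePreserving (fun z : ℝ × (Fin 2 → ℝ) => (![z.2 0, z.2 1, z.1] : V3)) ∧
    MeasurableEmbedding (fun z : ℝ × (Fin 2 → ℝ) => (![z.2 0, z.2 1, z.1] : V3)) := by
  have h := (volume_preserving_piFinSuccAbove (fun _ : Fin 3 => ℝ) 2).symm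
  have he := (MeasurableEquiv.piFinSuccAbove (fun _ : Fin 3 => ℝ) 2).symm.measurableEmbedding
  have e : (MeasurableEquiv.piFinSuccAbove (fun _ : Fin 3 => ℝ) 2).symm =
      (fun z : ℝ × (Fin 2 → ℝ) => (![z.2 0, z.2 1, z.1] : V3)) := by
    ext z : 1
    exact aux_ins z.1 z.2
  rw [e] at h he
  exact ⟨h, he⟩

lemma aux_zero (F : SchwartzMap (V3 × V3) ℂ) (hF : Inv3 ⇑F) (lam : ℝ) (hl : 0 < lam)
    (h : ∀ (l : ℕ) (r : ℝ), 
      ∫ x : V3, pft F x ![0, 0, lam] * ((lag l (lam / 2 * (x 0 ^ 2 + x 1 ^ 2)) : ℝ) : ℂ) *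
        Complex.exp (Complex.I * r * x 2) = 0) (x : V3) : pft F x ![0, 0, lam] = 0 := by
  set g : V3 → ℂ := fun x => pft F x ![0, 0, lam] with hg
  have hgc : Continuous g := aux_pft_cont F _
  have hgi : Integrable g := aux_pft_int F _
  obtain ⟨D, hD0, hD⟩ := aux_pft_decay F ![0, 0, lam]
  have hD' : ∀ (t : ℝ) (v : Fin 2 → ℝ), ‖g ![v 0, v 1, t]‖ ≤ D * (1 + ‖v‖) ^ (-4 : ℝ) := by
    intro t v
    refine (hD _).trans ?_
    gcongr D * ?_
    apply Real.rpow_le_rpow_of_nonpos (by positivity) _ (by norm_num)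
    gcongr
    rw [pi_norm_le_iff_of_nonneg (norm_nonneg _)]
    intro i
    fin_cases i
    · exact norm_le_pi_norm (![v 0, v 1, t] : V3) 0
    · exact norm_le_pi_norm (![v 0, v 1, t] : V3) 1
  obtain ⟨hmp, hme⟩ := aux_split
  have hslice : ∀ t : ℝ, (fun v : Fin 2 → ℝ => g ![v 0, v 1, t]) = 0 := by
    have hlag : ∀ l : ℕ, (fun t : ℝ => ∫ v : Fin 2 → ℝ, g ![v 0, v 1, t] *
        ((lag l (lam / 2 * (v 0 ^ 2 + v 1 ^ 2)) : ℝ) : ℂ)) = 0 := by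
      intro l
      obtain ⟨C, hC⟩ := aux_lag_bdd l
      have hlc := aux_lag_cont l
      have hC0 : 0 ≤ C := (abs_nonneg _).trans (hC 0 le_rfl)
      have hIz : Integrable (fun x : V3 => g x * ((lag l (lam / 2 * (x 0 ^ 2 + x 1 ^ 2)) : ℝ) : ℂ)) := by
        refine hgi.mul_bdd (c := C) (Continuous.aestronglyMeasurable (by fun_prop)) (Filter.Eventually.of_forall fun v => ?_)
        rw [Complex.norm_real]
        exact hC _ (by positivity)
      have hIz2 := (hmp.integrable_comp_emb hme).2 hIz
      rw [Measure.volume_eq_prod] at hIz2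
      apply aux_fourier_real
      · refine continuous_of_dominated (bound := fun v => D * (1 + ‖v‖) ^ (-4 : ℝ) * C) ?_ ?_ ?_ ?_
        · intro t
          exact Continuous.aestronglyMeasurable (by fun_prop)
        · intro t
          filter_upwards with v
          rw [norm_mul, Complex.norm_real]
          exact mul_le_mul (hD' t v) (hC _ (by positivity)) (norm_nonneg _) (by positivity)
        · exact ((aux_int4 (by norm_num)).const_mul D).mul_const C
        · filter_upwards with v
          fun_prop
      · exact hIz2.integral_prod_left
      · intro r
        have h1 := h l r
        rw [← hmp.integral_comp hme, Measure.volume_eq_prod, integral_prod] at h1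
        · rw [← h1]
          congr 1; ext t
          rw [← integral_mul_const]
          rfl
        · have hb : ∀ x : ℝ × (Fin 2 → ℝ), ‖Complex.exp (Complex.I * r * x.1)‖ ≤ 1 := by
            intro x
            have := aux_normexp (r * x.1)
            push_cast at this
            rw [mul_assoc, this]
          exact hIz2.mul_bdd (c := 1) (Continuous.aestronglyMeasurable (by fun_prop)) (Filter.Eventually.of_forall hb)
    intro t
    refine aux_radial _ (by fun_prop) ?_ ?_ lam hl (fun l => congrFun (hlag l) t)
    · exact ((aux_int4 (by norm_num)).const_mul D).mono' (Continuous.aestronglyMeasurable (by fun_prop))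
        (Filter.Eventually.of_forall (hD' t))
    · intro v
      obtain ⟨k, hk, hk1, hk2⟩ := aux_rot (v 0) (v 1) t
      have := aux_pft_inv F hF k hk ![v 0, v 1, t] ![0, 0, lam]
      rw [hk1, hk2] at this
      exact this.symm
  have := congrFun (hslice (x 2)) ![x 0, x 1]
  have e : x = ![x 0, x 1, x 2] := by ext i; fin_cases i <;> rfl
  rw [e]
  exact this

/-- Injectivity of the Gelfand (spherical) transform on `𝒮(N_{3,2})^{SO(3)}`. -/
theorem statement2 (μ : Measure Mat3) (hμ : IsHaarSO3 μ)
    (F : SchwartzMap (V3 × V3) ℂ) (hF : Inv3 ⇑F)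
    (hreg : ∀ lam > (0:ℝ), ∀ l : ℕ, ∀ r : ℝ,
      ∫ p : V3 × V3, F p * (starRingEnd ℂ) (sph μ lam l r p.1 p.2) = 0)
    (hsing : ∀ R ≥ (0:ℝ), ∫ p : V3 × V3, F p * (sph0 R p.1 : ℂ) = 0) :
    F = 0 := by
  have h0 : ∀ lam > (0:ℝ), ∀ x : V3, pft F x ![0, 0, lam] = 0 := fun lam hl =>
    aux_zero F hF lam hl fun l r => aux_red2 F lam hl l r
      (aux_red1 μ hμ F hF lam hl l r (hreg lam hl l r))
  have h1 : ∀ x w : V3, w ≠ 0 → pft F x w = 0 := by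
    intro x w hw
    obtain ⟨k, hk, lam, hl, hkw⟩ := aux_trans w hw
    rw [← aux_pft_inv F hF k hk, hkw, h0 lam hl]
  have hFc : Continuous F := F.continuous
  obtain ⟨C, hC0, hC⟩ := aux_decay F
  ext ⟨x, y⟩
  refine congrFun (aux_fourier_V3 (fun y => F (x, y)) (by fun_prop) ?_ (h1 x)) y
  refine (((aux_int4 (by norm_num)).const_mul (C * (1 + ‖x‖) ^ (-4 : ℝ)))).mono'
    (Continuous.aestronglyMeasurable (by fun_prop)) (Filter.Eventually.of_forall fun y => ?_)
  rw [mul_assoc]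
  exact hC x y
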